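/- Let Ω ⊆ ℝ² be open and connected, let f : Ω × ℝ → ℝ be smooth, let C ∈ ℝ, and let η : Ω → ℝ be smooth with ∂η/∂y ≠ 0 everywhere. Suppose that for all (x, y) ∈ Ω and all p ∈ ℝ, η_{xx}(x,y) + 2p·η_{xy}(x,y) + p²·η_{yy}(x,y) + η_y(x,y)·f(x,y,p) = 6·η(x,y)² + x + C. Define I₁ = −(1/4)·f_p² − f_y + (1/2)·D_x f_p on Ω × ℝ, where D_x = ∂/∂x + p·∂/∂y + f·∂/∂p. Then for all (x, y, p) ∈ Ω × ℝ, C = −(1/24)·I₁² − (1/12)·D_x²I₁ − x; in particular the function −(1/24)·I₁² − (1/12)·D_x²I₁ − x is constant on Ω × ℝ. -/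

import Mathlib

/-- Partial derivative in the first variable `x` of a function of `(x, y, p)`. -/
noncomputable def pdx (g : ℝ → ℝ → ℝ → ℝ) : ℝ → ℝ → ℝ → ℝ :=
  fun x y p => deriv (fun t => g t y p) x

/-- Partial derivative in the second variable `y` of a function of `(x, y, p)`. -/
noncomputable def pdy (g : ℝ → ℝ → ℝ → ℝ) : ℝ → ℝ → ℝ → ℝ :=
  fun x y p => deriv (fun t => g x t p) y

/-- Partial derivative in the third variable `p` of a function of `(x, y, p)`. -/
noncomputable def pdp (g : ℝ → ℝ → ℝ → ℝ) : ℝ → ℝ → ℝ → ℝ :=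
  fun x y p => deriv (fun t => g x y t) p

/-- Partial derivative in `x` of a function of `(x, y)`. -/
noncomputable def edx (g : ℝ → ℝ → ℝ) : ℝ → ℝ → ℝ :=
  fun x y => deriv (fun t => g t y) x

/-- Partial derivative in `y` of a function of `(x, y)`. -/
noncomputable def edy (g : ℝ → ℝ → ℝ) : ℝ → ℝ → ℝ :=
  fun x y => deriv (fun t => g x t) y

/-- Total derivative `D_x = ∂/∂x + p·∂/∂y + f·∂/∂p` along `y'' = f(x, y, y')`. -/
noncomputable def DxOp (f g : ℝ → ℝ → ℝ → ℝ) : ℝ → ℝ → ℝ → ℝ :=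
  fun x y p => pdx g x y p + p * pdy g x y p + f x y p * pdp g x y p

/-- Fundamental invariant `I₁ = -(1/4)·f_p² - f_y + (1/2)·D_x f_p`,
as a function of `(x, y, p)`. -/
noncomputable def inv1 (f : ℝ → ℝ → ℝ → ℝ) : ℝ → ℝ → ℝ → ℝ :=
  fun x y p =>
    -(1 / 4) * (pdp f x y p) ^ 2 - pdy f x y p + (1 / 2) * DxOp f (pdp f) x y p

open Filter Topology

section PlanarPartials

variable {Ω : Set (ℝ × ℝ)} {g : ℝ → ℝ → ℝ} {x y : ℝ}

lemma eventually_mem_fst (hΩ : IsOpen Ω) (h : (x, y) ∈ Ω) : ∀ᶠ t in 𝓝 x, (t, y) ∈ Ω :=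
  (Continuous.prodMk_left y).continuousAt.eventually_mem (hΩ.mem_nhds h)

lemma eventually_mem_snd (hΩ : IsOpen Ω) (h : (x, y) ∈ Ω) : ∀ᶠ t in 𝓝 y, (x, t) ∈ Ω :=
  (Continuous.prodMk_right x).continuousAt.eventually_mem (hΩ.mem_nhds h)

lemma hasFDerivAt_of_contDiffOn (hΩ : IsOpen Ω)
    (hg : ContDiffOn ℝ (⊤ : ℕ∞) (fun w : ℝ × ℝ => g w.1 w.2) Ω) {w : ℝ × ℝ} (h : w ∈ Ω) :
    HasFDerivAt (fun w : ℝ × ℝ => g w.1 w.2) (fderiv ℝ (fun w : ℝ × ℝ => g w.1 w.2) w) w :=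
  ((hg.contDiffAt (hΩ.mem_nhds h)).differentiableAt (by simp)).hasFDerivAt

lemma hasDerivAt_fst_fderiv (hΩ : IsOpen Ω)
    (hg : ContDiffOn ℝ (⊤ : ℕ∞) (fun w : ℝ × ℝ => g w.1 w.2) Ω) (h : (x, y) ∈ Ω) :
    HasDerivAt (fun t => g t y) (fderiv ℝ (fun w : ℝ × ℝ => g w.1 w.2) (x, y) (1, 0)) x :=
  HasFDerivAt.comp_hasDerivAt (f := fun t => (t, y)) x (hasFDerivAt_of_contDiffOn hΩ hg h)
    ((hasDerivAt_id x).prodMk (hasDerivAt_const x y))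

lemma hasDerivAt_snd_fderiv (hΩ : IsOpen Ω)
    (hg : ContDiffOn ℝ (⊤ : ℕ∞) (fun w : ℝ × ℝ => g w.1 w.2) Ω) (h : (x, y) ∈ Ω) :
    HasDerivAt (fun t => g x t) (fderiv ℝ (fun w : ℝ × ℝ => g w.1 w.2) (x, y) (0, 1)) y :=
  HasFDerivAt.comp_hasDerivAt (f := fun t => (x, t)) y (hasFDerivAt_of_contDiffOn hΩ hg h)
    ((hasDerivAt_const y x).prodMk (hasDerivAt_id y))

lemma hasDerivAt_edx (hΩ : IsOpen Ω)
    (hg : ContDiffOn ℝ (⊤ : ℕ∞) (fun w : ℝ × ℝ => g w.1 w.2) Ω) (h : (x, y) ∈ Ω) :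
    HasDerivAt (fun t => g t y) (edx g x y) x :=
  (hasDerivAt_fst_fderiv hΩ hg h).differentiableAt.hasDerivAt

lemma hasDerivAt_edy (hΩ : IsOpen Ω)
    (hg : ContDiffOn ℝ (⊤ : ℕ∞) (fun w : ℝ × ℝ => g w.1 w.2) Ω) (h : (x, y) ∈ Ω) :
    HasDerivAt (fun t => g x t) (edy g x y) y :=
  (hasDerivAt_snd_fderiv hΩ hg h).differentiableAt.hasDerivAt

lemma edx_eq_fderiv (hΩ : IsOpen Ω)
    (hg : ContDiffOn ℝ (⊤ : ℕ∞) (fun w : ℝ × ℝ => g w.1 w.2) Ω) {w : ℝ × ℝ} (h : w ∈ Ω) :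
    edx g w.1 w.2 = fderiv ℝ (fun w : ℝ × ℝ => g w.1 w.2) w (1, 0) :=
  (hasDerivAt_fst_fderiv hΩ hg h).deriv

lemma edy_eq_fderiv (hΩ : IsOpen Ω)
    (hg : ContDiffOn ℝ (⊤ : ℕ∞) (fun w : ℝ × ℝ => g w.1 w.2) Ω) {w : ℝ × ℝ} (h : w ∈ Ω) :
    edy g w.1 w.2 = fderiv ℝ (fun w : ℝ × ℝ => g w.1 w.2) w (0, 1) :=
  (hasDerivAt_snd_fderiv hΩ hg h).deriv

lemma contDiffOn_edx (hΩ : IsOpen Ω)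
    (hg : ContDiffOn ℝ (⊤ : ℕ∞) (fun w : ℝ × ℝ => g w.1 w.2) Ω) :
    ContDiffOn ℝ (⊤ : ℕ∞) (fun w : ℝ × ℝ => edx g w.1 w.2) Ω :=
  ((hg.fderiv_of_isOpen hΩ (m := (⊤ : ℕ∞)) (by simp)).clm_apply contDiffOn_const).congr
    fun _ h => edx_eq_fderiv hΩ hg h

lemma contDiffOn_edy (hΩ : IsOpen Ω)
    (hg : ContDiffOn ℝ (⊤ : ℕ∞) (fun w : ℝ × ℝ => g w.1 w.2) Ω) :
    ContDiffOn ℝ (⊤ : ℕ∞) (fun w : ℝ × ℝ => edy g w.1 w.2) Ω :=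
  ((hg.fderiv_of_isOpen hΩ (m := (⊤ : ℕ∞)) (by simp)).clm_apply contDiffOn_const).congr
    fun _ h => edy_eq_fderiv hΩ hg h

/-- Mixed second partial derivatives of a smooth function commute. -/
lemma edy_edx_eq_edx_edy (hΩ : IsOpen Ω)
    (hg : ContDiffOn ℝ (⊤ : ℕ∞) (fun w : ℝ × ℝ => g w.1 w.2) Ω) (h : (x, y) ∈ Ω) :
    edy (edx g) x y = edx (edy g) x y := by
  set G : ℝ × ℝ → ℝ := fun w => g w.1 w.2
  have hG : ContDiffAt ℝ (⊤ : ℕ∞) G (x, y) := hg.contDiffAt (hΩ.mem_nhds h)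
  have hdG : DifferentiableAt ℝ (fderiv ℝ G) (x, y) :=
    (hG.fderiv_right (m := 1) (by norm_cast)).differentiableAt (by simp)
  have key (v : ℝ × ℝ) : fderiv ℝ (fun w => fderiv ℝ G w v) (x, y)
      = (fderiv ℝ (fderiv ℝ G) (x, y)).flip v := by
    ext <;> simp [fderiv_clm_apply hdG (differentiableAt_const v)]
  have hx : (fun w : ℝ × ℝ => edx g w.1 w.2) =ᶠ[𝓝 (x, y)] fun w => fderiv ℝ G w (1, 0) := by
    filter_upwards [hΩ.mem_nhds h] with w hw using edx_eq_fderiv hΩ hg hw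
  have hy : (fun w : ℝ × ℝ => edy g w.1 w.2) =ᶠ[𝓝 (x, y)] fun w => fderiv ℝ G w (0, 1) := by
    filter_upwards [hΩ.mem_nhds h] with w hw using edy_eq_fderiv hΩ hg hw
  have hsymm : IsSymmSndFDerivAt ℝ G (x, y) :=
    hG.isSymmSndFDerivAt (by rw [minSmoothness_of_isRCLikeNormedField]; norm_cast)
  rw [edy_eq_fderiv hΩ (contDiffOn_edx hΩ hg) h, edx_eq_fderiv hΩ (contDiffOn_edy hΩ hg) h,
    hx.fderiv_eq, hy.fderiv_eq, key, key]
  exact hsymm (0, 1) (1, 0)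

end PlanarPartials

section QuadraticInVelocity

variable {Ω : Set (ℝ × ℝ)} {g : ℝ → ℝ → ℝ → ℝ} {P Q R : ℝ → ℝ → ℝ} {x y P' Q' R' : ℝ}

lemma pdx_of_quadratic (hΩ : IsOpen Ω)
    (hg : ∀ w ∈ Ω, ∀ p, g w.1 w.2 p = P w.1 w.2 + p * Q w.1 w.2 + p ^ 2 * R w.1 w.2)
    (h : (x, y) ∈ Ω) (hP : HasDerivAt (fun t => P t y) P' x)
    (hQ : HasDerivAt (fun t => Q t y) Q' x) (hR : HasDerivAt (fun t => R t y) R' x) (p : ℝ) :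
    pdx g x y p = P' + p * Q' + p ^ 2 * R' := by
  refine HasDerivAt.deriv <|
    ((hP.add (hQ.const_mul p)).add (hR.const_mul (p ^ 2))).congr_of_eventuallyEq ?_
  filter_upwards [eventually_mem_fst hΩ h] with t ht using hg _ ht p

lemma pdy_of_quadratic (hΩ : IsOpen Ω)
    (hg : ∀ w ∈ Ω, ∀ p, g w.1 w.2 p = P w.1 w.2 + p * Q w.1 w.2 + p ^ 2 * R w.1 w.2)
    (h : (x, y) ∈ Ω) (hP : HasDerivAt (fun t => P x t) P' y)
    (hQ : HasDerivAt (fun t => Q x t) Q' y) (hR : HasDerivAt (fun t => R x t) R' y) (p : ℝ) :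
    pdy g x y p = P' + p * Q' + p ^ 2 * R' := by
  refine HasDerivAt.deriv <|
    ((hP.add (hQ.const_mul p)).add (hR.const_mul (p ^ 2))).congr_of_eventuallyEq ?_
  filter_upwards [eventually_mem_snd hΩ h] with t ht using hg _ ht p

lemma pdp_of_quadratic
    (hg : ∀ w ∈ Ω, ∀ p, g w.1 w.2 p = P w.1 w.2 + p * Q w.1 w.2 + p ^ 2 * R w.1 w.2)
    (h : (x, y) ∈ Ω) (p : ℝ) : pdp g x y p = Q x y + 2 * p * R x y := by
  have hfun : (fun t => g x y t) = fun t => P x y + t * Q x y + t ^ 2 * R x y :=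
    funext fun t => hg _ h t
  have hd := (((hasDerivAt_id p).mul_const (Q x y)).const_add (P x y)).add
    (((hasDerivAt_id p).pow 2).mul_const (R x y))
  rw [pdp, hfun]
  refine (hd.congr_deriv ?_).deriv
  simp

end QuadraticInVelocity

section PainleveOne

variable {Ω : Set (ℝ × ℝ)} {f : ℝ → ℝ → ℝ → ℝ} {η : ℝ → ℝ → ℝ} {C : ℝ}

/-- The fundamental invariant of an equation carried to the first Painlevé equation
is `-12 η`. -/
lemma inv1_eq_neg_twelve_mul (hΩ : IsOpen Ω)
    (hη : ContDiffOn ℝ (⊤ : ℕ∞) (fun w : ℝ × ℝ => η w.1 w.2) Ω)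
    (hηy : ∀ w ∈ Ω, edy η w.1 w.2 ≠ 0)
    (hpde : ∀ w ∈ Ω, ∀ p : ℝ,
      edx (edx η) w.1 w.2 + 2 * p * edx (edy η) w.1 w.2
        + p ^ 2 * edy (edy η) w.1 w.2 + edy η w.1 w.2 * f w.1 w.2 p
      = 6 * (η w.1 w.2) ^ 2 + w.1 + C)
    {x y : ℝ} (h : (x, y) ∈ Ω) (p : ℝ) : inv1 f x y p = -12 * η x y := by
  have sy := contDiffOn_edy hΩ hη
  have sxx := contDiffOn_edx hΩ (contDiffOn_edx hΩ hη)
  have sxy := contDiffOn_edx hΩ sy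
  have syy := contDiffOn_edy hΩ sy
  have hf : ∀ w ∈ Ω, ∀ p, f w.1 w.2 p =
      (6 * η w.1 w.2 ^ 2 + w.1 + C - edx (edx η) w.1 w.2) / edy η w.1 w.2
      + p * (-2 * edx (edy η) w.1 w.2 / edy η w.1 w.2)
      + p ^ 2 * (-edy (edy η) w.1 w.2 / edy η w.1 w.2) := by
    intro w hw p
    have := hηy w hw
    field_simp
    linear_combination hpde w hw p
  have hfp : ∀ w ∈ Ω, ∀ p, pdp f w.1 w.2 p =
      -2 * edx (edy η) w.1 w.2 / edy η w.1 w.2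
      + p * (-2 * edy (edy η) w.1 w.2 / edy η w.1 w.2) + p ^ 2 * (0 : ℝ) := by
    intro w hw p
    rw [pdp_of_quadratic (P := fun x y => (6 * η x y ^ 2 + x + C - edx (edx η) x y) / edy η x y)
      (Q := fun x y => -2 * edx (edy η) x y / edy η x y)
      (R := fun x y => -edy (edy η) x y / edy η x y) hf hw p]
    ring
  have h0 : edy η x y ≠ 0 := hηy _ h
  have dPy : HasDerivAt
      (fun t => (6 * η x t ^ 2 + x + C - edx (edx η) x t) / edy η x t) _ y :=
    ((((((hasDerivAt_edy hΩ hη h).pow 2).const_mul 6).add_const x).add_const C).sub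
      (hasDerivAt_edy hΩ sxx h)).div (hasDerivAt_edy hΩ sy h) h0
  have dQx : HasDerivAt (fun t => -2 * edx (edy η) t y / edy η t y) _ x :=
    ((hasDerivAt_edx hΩ sxy h).const_mul (-2)).div (hasDerivAt_edx hΩ sy h) h0
  have dQy : HasDerivAt (fun t => -2 * edx (edy η) x t / edy η x t) _ y :=
    ((hasDerivAt_edy hΩ sxy h).const_mul (-2)).div (hasDerivAt_edy hΩ sy h) h0
  have dRy : HasDerivAt (fun t => -edy (edy η) x t / edy η x t) _ y :=
    (hasDerivAt_edy hΩ syy h).neg.div (hasDerivAt_edy hΩ sy h) h0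
  have dSx : HasDerivAt (fun t => -2 * edy (edy η) t y / edy η t y) _ x :=
    ((hasDerivAt_edx hΩ syy h).const_mul (-2)).div (hasDerivAt_edx hΩ sy h) h0
  have dSy : HasDerivAt (fun t => -2 * edy (edy η) x t / edy η x t) _ y :=
    ((hasDerivAt_edy hΩ syy h).const_mul (-2)).div (hasDerivAt_edy hΩ sy h) h0
  have e1 : edy (edx (edx η)) x y = edx (edx (edy η)) x y := by
    rw [edy_edx_eq_edx_edy hΩ (contDiffOn_edx hΩ hη) h]
    refine EventuallyEq.deriv_eq ?_
    filter_upwards [eventually_mem_fst hΩ h] with t ht using edy_edx_eq_edx_edy hΩ hη ht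
  have e2 : edy (edx (edy η)) x y = edx (edy (edy η)) x y := edy_edx_eq_edx_edy hΩ sy h
  have fpp := pdp_of_quadratic (P := fun x y => -2 * edx (edy η) x y / edy η x y)
    (Q := fun x y => -2 * edy (edy η) x y / edy η x y) (R := fun _ _ => 0) hfp h p
  have fpx := pdx_of_quadratic (P := fun x y => -2 * edx (edy η) x y / edy η x y)
    (Q := fun x y => -2 * edy (edy η) x y / edy η x y) (R := fun _ _ => 0) hΩ hfp h
    dQx dSx (hasDerivAt_const x 0) p
  have fpy := pdy_of_quadratic (P := fun x y => -2 * edx (edy η) x y / edy η x y)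
    (Q := fun x y => -2 * edy (edy η) x y / edy η x y) (R := fun _ _ => 0) hΩ hfp h
    dQy dSy (hasDerivAt_const y 0) p
  have fy := pdy_of_quadratic
    (P := fun x y => (6 * η x y ^ 2 + x + C - edx (edx η) x y) / edy η x y)
    (Q := fun x y => -2 * edx (edy η) x y / edy η x y)
    (R := fun x y => -edy (edy η) x y / edy η x y) hΩ hf h dPy dQy dRy p
  rw [inv1, DxOp, fpp, fpx, fpy, fy, hfp _ h p, hf _ h p, e1, e2]
  simp only [Pi.sub_apply, Pi.neg_apply, Pi.pow_apply]
  field_simp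
  ring

end PainleveOne

/-- If `(x, y) ↦ (x + C, η(x, y))` maps `y'' = f(x, y, y')` to the first
Painlevé equation, then the shift `C` is recovered from the invariant `I₁`:
`C = -(1/24)·I₁² - (1/12)·D_x²I₁ - x` on `Ω × ℝ`; in particular that expression is
constant on `Ω × ℝ`. -/
theorem statement10
    (Ω : Set (ℝ × ℝ)) (hΩo : IsOpen Ω) (hΩc : IsConnected Ω)
    (f : ℝ → ℝ → ℝ → ℝ)
    (hf : ContDiffOn ℝ (⊤ : ℕ∞) (fun z : ℝ × ℝ × ℝ => f z.1 z.2.1 z.2.2)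
      {z : ℝ × ℝ × ℝ | (z.1, z.2.1) ∈ Ω})
    (C : ℝ) (η : ℝ → ℝ → ℝ)
    (hη : ContDiffOn ℝ (⊤ : ℕ∞) (fun w : ℝ × ℝ => η w.1 w.2) Ω)
    (hηy : ∀ w ∈ Ω, edy η w.1 w.2 ≠ 0)
    (hpde : ∀ w ∈ Ω, ∀ p : ℝ,
      edx (edx η) w.1 w.2 + 2 * p * edx (edy η) w.1 w.2
        + p ^ 2 * edy (edy η) w.1 w.2 + edy η w.1 w.2 * f w.1 w.2 p
      = 6 * (η w.1 w.2) ^ 2 + w.1 + C) :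
    ∀ w ∈ Ω, ∀ p : ℝ,
      C = -(1 / 24) * (inv1 f w.1 w.2 p) ^ 2
            - (1 / 12) * DxOp f (DxOp f (inv1 f)) w.1 w.2 p - w.1 := by
  have I (w) (hw : w ∈ Ω) (p : ℝ) : inv1 f w.1 w.2 p
      = -12 * η w.1 w.2 + p * (0 : ℝ) + p ^ 2 * (0 : ℝ) := by
    rw [inv1_eq_neg_twelve_mul hΩo hη hηy hpde hw]
    ring
  have DI (w) (hw : w ∈ Ω) (p : ℝ) : DxOp f (inv1 f) w.1 w.2 p
      = -12 * edx η w.1 w.2 + p * (-12 * edy η w.1 w.2) + p ^ 2 * (0 : ℝ) := by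
    rw [DxOp, pdx_of_quadratic (P := fun x y => -12 * η x y) (Q := fun _ _ => 0)
        (R := fun _ _ => 0) hΩo I hw ((hasDerivAt_edx hΩo hη hw).const_mul (-12))
        (hasDerivAt_const _ 0) (hasDerivAt_const _ 0),
      pdy_of_quadratic (P := fun x y => -12 * η x y) (Q := fun _ _ => 0)
        (R := fun _ _ => 0) hΩo I hw ((hasDerivAt_edy hΩo hη hw).const_mul (-12))
        (hasDerivAt_const _ 0) (hasDerivAt_const _ 0),
      pdp_of_quadratic (P := fun x y => -12 * η x y) (Q := fun _ _ => 0)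
        (R := fun _ _ => 0) I hw]
    ring
  intro w hw p
  have sx := contDiffOn_edx hΩo hη
  have sy := contDiffOn_edy hΩo hη
  rw [DxOp, pdx_of_quadratic (P := fun x y => -12 * edx η x y) (Q := fun x y => -12 * edy η x y)
      (R := fun _ _ => 0) hΩo DI hw ((hasDerivAt_edx hΩo sx hw).const_mul (-12))
      ((hasDerivAt_edx hΩo sy hw).const_mul (-12)) (hasDerivAt_const _ 0),
    pdy_of_quadratic (P := fun x y => -12 * edx η x y) (Q := fun x y => -12 * edy η x y)
      (R := fun _ _ => 0) hΩo DI hw ((hasDerivAt_edy hΩo sx hw).const_mul (-12))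
      ((hasDerivAt_edy hΩo sy hw).const_mul (-12)) (hasDerivAt_const _ 0),
    pdp_of_quadratic (P := fun x y => -12 * edx η x y) (Q := fun x y => -12 * edy η x y)
      (R := fun _ _ => 0) DI hw,
    I w hw p, edy_edx_eq_edx_edy hΩo hη hw]
  linear_combination -hpde w hw p
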